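/- arXiv:2602.23775 — 3 statements merged into one kernel-verified Lean document; each statement's English description precedes it below -/
import Mathlib

section
/- Let λ0, λ1, λ2 > 0 and let (X1, X2) be a random vector taking values in ℕ × ℕ. Suppose that for every bounded function f : ℕ × ℕ → ℝ both identities hold: E[X1 · f(X1, X2)] = λ1 · E[f(X1 + 1, X2)] + λ0 · E[f(X1 + 1, X2 + 1)] and E[X2 · f(X1, X2)] = λ2 · E[f(X1, X2 + 1)] + λ0 · E[f(X1 + 1, X2 + 1)]. Then (X1, X2) follows the bivariate Poisson distribution BPoi(λ0; λ1, λ2); equivalently, its joint probability generating function satisfies E[s^{X1} t^{X2}] = exp(λ1(s − 1) + λ2(t − 1) + λ0(st − 1)) for all s, t with |s|, |t| < 1. -/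
open scoped NNReal ENNReal

/-- The bivariate Poisson distribution `BPoi(λ0; λ1, λ2)`: the distribution of
`(Z0 + Z1, Z0 + Z2)` where `Z0, Z1, Z2` are independent with `Zi ~ Poisson(λi)`. -/
noncomputable def bpoi (l0 l1 l2 : ℝ≥0) : PMF (ℕ × ℕ) :=
  (ProbabilityTheory.poissonPMF l0).bind fun z0 =>
    (ProbabilityTheory.poissonPMF l1).bind fun z1 =>
      (ProbabilityTheory.poissonPMF l2).map fun z2 => (z0 + z1, z0 + z2)

/-- Expectation of a real-valued function under a distribution on `ℕ × ℕ`. -/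
noncomputable def pExp (p : PMF (ℕ × ℕ)) (g : ℕ × ℕ → ℝ) : ℝ :=
  ∑' q : ℕ × ℕ, (p q).toReal * g q

namespace BivariatePoisson

open ProbabilityTheory

set_option linter.deprecated false

/-- The first-order recursion satisfied by the mass function of the bivariate Poisson
distribution. -/
structure IsRecursive (l0 l1 l2 : ℝ) (w : ℕ × ℕ → ℝ) : Prop where
  succ_zero : ∀ a : ℕ, ((a : ℝ) + 1) * w (a + 1, 0) = l1 * w (a, 0)
  succ_succ : ∀ a b : ℕ,
    ((a : ℝ) + 1) * w (a + 1, b + 1) = l1 * w (a, b + 1) + l0 * w (a, b)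
  zero_succ : ∀ b : ℕ, ((b : ℝ) + 1) * w (0, b + 1) = l2 * w (0, b)

theorem IsRecursive.mul_const {l0 l1 l2 : ℝ} {w : ℕ × ℕ → ℝ} (h : IsRecursive l0 l1 l2 w)
    (c : ℝ) : IsRecursive l0 l1 l2 (fun q => w q * c) where
  succ_zero a := by linear_combination c * h.succ_zero a
  succ_succ a b := by linear_combination c * h.succ_succ a b
  zero_succ b := by linear_combination c * h.zero_succ b

theorem IsRecursive.eq_of_zero {l0 l1 l2 : ℝ} {w v : ℕ × ℕ → ℝ} (hw : IsRecursive l0 l1 l2 w)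
    (hv : IsRecursive l0 l1 l2 v) (h : w (0, 0) = v (0, 0)) : w = v := by
  have hcol : ∀ b, w (0, b) = v (0, b) := by
    intro b
    induction b with
    | zero => exact h
    | succ b ih =>
      refine mul_left_cancel₀ (b := w (0, b + 1)) (Nat.cast_add_one_ne_zero (R := ℝ) b) ?_
      rw [hw.zero_succ, hv.zero_succ, ih]
  have hall : ∀ a b, w (a, b) = v (a, b) := by
    intro a
    induction a with
    | zero => exact hcol
    | succ a ih =>
      intro b
      refine mul_left_cancel₀ (b := w (a + 1, b)) (Nat.cast_add_one_ne_zero (R := ℝ) a) ?_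
      cases b with
      | zero => rw [hw.succ_zero, hv.succ_zero, ih]
      | succ b => rw [hw.succ_succ, hv.succ_succ, ih, ih]
  exact funext fun q => hall q.1 q.2

theorem tsum_toReal_pmf {α : Type*} (p : PMF α) : ∑' a, (p a).toReal = 1 := by
  rw [← ENNReal.tsum_toReal_eq fun a => p.apply_ne_top a, p.tsum_coe, ENNReal.toReal_one]

/-- The recursion determines a probability mass function. -/
theorem eq_of_isRecursive {l0 l1 l2 : ℝ} {p q : PMF (ℕ × ℕ)}
    (hp : IsRecursive l0 l1 l2 fun x => (p x).toReal)
    (hq : IsRecursive l0 l1 l2 fun x => (q x).toReal) : p = q := by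
  have h := (hp.mul_const (q (0, 0)).toReal).eq_of_zero (hq.mul_const (p (0, 0)).toReal)
    (mul_comm _ _)
  have h00 : (q (0, 0)).toReal = (p (0, 0)).toReal := by
    have := congrArg (fun w : ℕ × ℕ → ℝ => ∑' x, w x) h
    simpa only [tsum_mul_right, tsum_toReal_pmf, one_mul] using this
  ext x
  exact (ENNReal.toReal_eq_toReal_iff' (p.apply_ne_top x) (q.apply_ne_top x)).1
    (congrFun (hp.eq_of_zero hq h00.symm) x)

theorem tsum_bind_mul {α β : Type*} (p : PMF α) (f : α → PMF β) (g : β → ℝ≥0∞) :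
    ∑' b, p.bind f b * g b = ∑' a, p a * ∑' b, f a b * g b := by
  simp_rw [PMF.bind_apply, ← ENNReal.tsum_mul_right, ← ENNReal.tsum_mul_left, mul_assoc]
  exact ENNReal.tsum_comm

theorem tsum_pure_mul {β : Type*} (b : β) (g : β → ℝ≥0∞) :
    ∑' x, PMF.pure b x * g x = g b := by
  rw [tsum_eq_single b (by intro x hx; simp [hx])]
  simp

theorem tsum_map_mul {α β : Type*} (p : PMF α) (f : α → β) (g : β → ℝ≥0∞) :
    ∑' b, p.map f b * g b = ∑' a, p a * g (f a) := by
  rw [← PMF.bind_pure_comp, tsum_bind_mul]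
  simp_rw [Function.comp_apply, tsum_pure_mul]

theorem tsum_bpoi_mul (l0 l1 l2 : ℝ≥0) (g : ℕ × ℕ → ℝ≥0∞) :
    ∑' q, bpoi l0 l1 l2 q * g q = ∑' z0, poissonPMF l0 z0 *
      ∑' z1, poissonPMF l1 z1 * ∑' z2, poissonPMF l2 z2 * g (z0 + z1, z0 + z2) := by
  simp_rw [bpoi, tsum_bind_mul, tsum_map_mul]

theorem toReal_poissonPMF (l : ℝ≥0) (n : ℕ) :
    (poissonPMF l n).toReal = Real.exp (-l) * (l : ℝ) ^ n / n.factorial := by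
  rw [← poissonPMFReal_ofReal_eq_poissonPMF, ENNReal.toReal_ofReal poissonPMFReal_nonneg,
    poissonPMFReal]

theorem poissonPMF_succ (l : ℝ≥0) (n : ℕ) :
    poissonPMF l (n + 1) * ((n + 1 : ℕ) : ℝ≥0∞) = l * poissonPMF l n := by
  refine (ENNReal.toReal_eq_toReal_iff'
    (ENNReal.mul_ne_top (PMF.apply_ne_top _ _) (ENNReal.natCast_ne_top _))
    (ENNReal.mul_ne_top ENNReal.coe_ne_top (PMF.apply_ne_top _ _))).1 ?_
  simp only [ENNReal.toReal_mul, toReal_poissonPMF, ENNReal.toReal_natCast, ENNReal.coe_toReal,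
    Nat.factorial_succ]
  have : (n.factorial : ℝ) ≠ 0 := by positivity
  push_cast
  field_simp
  ring

/-- The Stein identity of the univariate Poisson distribution. -/
theorem tsum_poissonPMF_mul_natCast (l : ℝ≥0) (g : ℕ → ℝ≥0∞) :
    ∑' n, poissonPMF l n * ((n : ℝ≥0∞) * g n) = l * ∑' n, poissonPMF l n * g (n + 1) := by
  rw [tsum_eq_zero_add' ENNReal.summable, ← ENNReal.tsum_mul_left]
  simp only [Nat.cast_zero, zero_mul, mul_zero, zero_add]
  refine tsum_congr fun n => ?_
  rw [← mul_assoc, poissonPMF_succ, mul_assoc]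

/-- The Stein identity of the bivariate Poisson distribution in the first coordinate. -/
theorem tsum_bpoi_mul_fst (l0 l1 l2 : ℝ≥0) (g : ℕ × ℕ → ℝ≥0∞) :
    ∑' q, bpoi l0 l1 l2 q * ((q.1 : ℝ≥0∞) * g q) =
      l1 * ∑' q, bpoi l0 l1 l2 q * g (q.1 + 1, q.2) +
        l0 * ∑' q, bpoi l0 l1 l2 q * g (q.1 + 1, q.2 + 1) := by
  have h1 : ∀ z0 : ℕ, ∑' z1, poissonPMF l1 z1 * ((z1 : ℝ≥0∞) *
      ∑' z2, poissonPMF l2 z2 * g (z0 + z1, z0 + z2)) =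
      l1 * ∑' z1, poissonPMF l1 z1 * ∑' z2, poissonPMF l2 z2 * g (z0 + z1 + 1, z0 + z2) :=
    fun z0 => tsum_poissonPMF_mul_natCast l1 _
  have h0 := tsum_poissonPMF_mul_natCast l0 fun z0 => ∑' z1, poissonPMF l1 z1 *
      ∑' z2, poissonPMF l2 z2 * g (z0 + z1, z0 + z2)
  simp only [tsum_bpoi_mul]
  simp only [add_right_comm _ 1] at h0
  rw [← h0, ← ENNReal.tsum_mul_left, ← ENNReal.tsum_add]
  refine tsum_congr fun z0 => ?_
  rw [mul_left_comm, ← h1, ← mul_add]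
  congr 1
  rw [← ENNReal.tsum_mul_left, ← ENNReal.tsum_add]
  refine tsum_congr fun z1 => ?_
  rw [mul_left_comm (z0 : ℝ≥0∞), ← mul_add, ← add_mul]
  congr 1
  rw [← ENNReal.tsum_mul_left]
  refine tsum_congr fun z2 => ?_
  push_cast
  ring

theorem tsum_bpoi_mul_swap (l0 l1 l2 : ℝ≥0) (g : ℕ × ℕ → ℝ≥0∞) :
    ∑' q, bpoi l0 l1 l2 q * g q = ∑' q, bpoi l0 l2 l1 q * g q.swap := by
  simp only [tsum_bpoi_mul, Prod.swap_prod_mk]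
  refine tsum_congr fun z0 => ?_
  congr 1
  simp_rw [← ENNReal.tsum_mul_left]
  rw [ENNReal.tsum_comm]
  simp_rw [mul_left_comm]

/-- The Stein identity of the bivariate Poisson distribution in the second coordinate. -/
theorem tsum_bpoi_mul_snd (l0 l1 l2 : ℝ≥0) (g : ℕ × ℕ → ℝ≥0∞) :
    ∑' q, bpoi l0 l1 l2 q * ((q.2 : ℝ≥0∞) * g q) =
      l2 * ∑' q, bpoi l0 l1 l2 q * g (q.1, q.2 + 1) +
        l0 * ∑' q, bpoi l0 l1 l2 q * g (q.1 + 1, q.2 + 1) := by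
  simp only [tsum_bpoi_mul_swap l0 l1 l2]
  exact tsum_bpoi_mul_fst l0 l2 l1 fun q => g q.swap

theorem isRecursive_bpoi (l0 l1 l2 : ℝ≥0) :
    IsRecursive l0 l1 l2 fun q => (bpoi l0 l1 l2 q).toReal := by
  have key : ∀ (x : ℕ × ℕ) (f : ℕ × ℕ → ℝ≥0∞), (∀ y, y ≠ x → f y = 0) →
      ∑' q, bpoi l0 l1 l2 q * f q = bpoi l0 l1 l2 x * f x := fun x f hf =>
    tsum_eq_single x fun y hy => by rw [hf y hy, mul_zero]
  have hcast : ∀ n : ℕ, ((n : ℝ≥0∞) + 1).toReal = n + 1 := fun n => by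
    exact_mod_cast ENNReal.toReal_natCast (n + 1)
  have hne : ∀ (l : ℝ≥0) (x : ℕ × ℕ), (l : ℝ≥0∞) * bpoi l0 l1 l2 x ≠ ⊤ := fun l x =>
    ENNReal.mul_ne_top ENNReal.coe_ne_top (PMF.apply_ne_top _ x)
  constructor
  · intro a
    have h := tsum_bpoi_mul_fst l0 l1 l2 (Pi.single (a + 1, 0) 1)
    rw [key (a + 1, 0) _ (by intro y hy; simp [hy]),
      key (a, 0) _ (by rintro ⟨y, z⟩ hy; simpa [Pi.single_apply] using hy)] at h
    simpa [ENNReal.toReal_add (hne _ _) (hne _ _), hcast, mul_comm] using congrArg ENNReal.toReal h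
  · intro a b
    have h := tsum_bpoi_mul_fst l0 l1 l2 (Pi.single (a + 1, b + 1) 1)
    rw [key (a + 1, b + 1) _ (by intro y hy; simp [hy]),
      key (a, b + 1) _ (by rintro ⟨y, z⟩ hy; simpa [Pi.single_apply] using hy),
      key (a, b) _ (by rintro ⟨y, z⟩ hy; simpa [Pi.single_apply] using hy)] at h
    simpa [ENNReal.toReal_add (hne _ _) (hne _ _), hcast, mul_comm] using congrArg ENNReal.toReal h
  · intro b
    have h := tsum_bpoi_mul_snd l0 l1 l2 (Pi.single (0, b + 1) 1)
    rw [key (0, b + 1) _ (by intro y hy; simp [hy]),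
      key (0, b) _ (by rintro ⟨y, z⟩ hy; simpa [Pi.single_apply] using hy)] at h
    simpa [ENNReal.toReal_add (hne _ _) (hne _ _), hcast, mul_comm] using congrArg ENNReal.toReal h

theorem tsum_toReal_bind_mul {α β : Type*} (p : PMF α) (f : α → PMF β) {g : β → ℝ} {C : ℝ}
    (hg : ∀ b, |g b| ≤ C) :
    ∑' b, (p.bind f b).toReal * g b = ∑' a, (p a).toReal * ∑' b, (f a b).toReal * g b := by
  have hs : Summable fun x : α × β => (p x.1 * f x.1 x.2).toReal := by
    refine ENNReal.summable_toReal ?_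
    rw [ENNReal.tsum_prod (f := fun a b => p a * f a b)]
    simp [ENNReal.tsum_mul_left]
  have hs' : Summable fun x : α × β => (p x.1 * f x.1 x.2).toReal * g x.2 := by
    refine Summable.of_norm_bounded (hs.mul_right C) fun x => ?_
    rw [norm_mul, Real.norm_of_nonneg ENNReal.toReal_nonneg]
    exact mul_le_mul_of_nonneg_left (hg _) ENNReal.toReal_nonneg
  have hb : ∀ b, (p.bind f b).toReal = ∑' a, (p a * f a b).toReal := fun b => by
    rw [PMF.bind_apply, ENNReal.tsum_toReal_eq]
    exact fun a => ENNReal.mul_ne_top (p.apply_ne_top a) ((f a).apply_ne_top b)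
  simp_rw [hb, ← tsum_mul_right, ← tsum_mul_left]
  rw [Summable.tsum_comm (f := fun a b => (p a * f a b).toReal * g b) hs']
  simp_rw [ENNReal.toReal_mul, mul_assoc]

theorem tsum_toReal_map_mul {α β : Type*} (p : PMF α) (f : α → β) {g : β → ℝ} {C : ℝ}
    (hg : ∀ b, |g b| ≤ C) :
    ∑' b, (p.map f b).toReal * g b = ∑' a, (p a).toReal * g (f a) := by
  rw [← PMF.bind_pure_comp, tsum_toReal_bind_mul p _ hg]
  refine tsum_congr fun a => ?_
  rw [tsum_eq_single (f a) (by intro x hx; simp [hx])]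
  simp

theorem tsum_toReal_poissonPMF_mul_pow (l : ℝ≥0) (u : ℝ) :
    ∑' n, (poissonPMF l n).toReal * u ^ n = Real.exp (l * (u - 1)) := by
  have h := (NormedSpace.expSeries_div_hasSum_exp ((l : ℝ) * u)).mul_left (Real.exp (-l))
  rw [← Real.exp_eq_exp_ℝ, ← Real.exp_add] at h
  rw [show (l : ℝ) * (u - 1) = -l + l * u by ring, ← h.tsum_eq]
  refine tsum_congr fun n => ?_
  rw [toReal_poissonPMF, mul_pow]
  ring

/-- The joint probability generating function of the bivariate Poisson distribution. -/
theorem tsum_toReal_bpoi_mul_pow_mul_pow (l0 l1 l2 : ℝ≥0) {s t : ℝ} (hs : |s| ≤ 1)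
    (ht : |t| ≤ 1) :
    ∑' q : ℕ × ℕ, (bpoi l0 l1 l2 q).toReal * (s ^ q.1 * t ^ q.2) =
      Real.exp ((l1 : ℝ) * (s - 1) + (l2 : ℝ) * (t - 1) + (l0 : ℝ) * (s * t - 1)) := by
  have hg : ∀ q : ℕ × ℕ, |s ^ q.1 * t ^ q.2| ≤ 1 := fun q => by
    rw [abs_mul, abs_pow, abs_pow]
    exact mul_le_one₀ (pow_le_one₀ (abs_nonneg s) hs) (by positivity)
      (pow_le_one₀ (abs_nonneg t) ht)
  rw [bpoi, tsum_toReal_bind_mul _ _ hg]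
  simp_rw [tsum_toReal_bind_mul _ _ hg, tsum_toReal_map_mul _ _ hg]
  have h2 : ∀ z0 z1 : ℕ, ∑' z2, (poissonPMF l2 z2).toReal * (s ^ (z0 + z1) * t ^ (z0 + z2)) =
      s ^ z1 * ((s * t) ^ z0 * Real.exp (l2 * (t - 1))) := fun z0 z1 => by
    rw [← tsum_toReal_poissonPMF_mul_pow, ← tsum_mul_left, ← tsum_mul_left]
    refine tsum_congr fun z2 => ?_
    ring
  simp_rw [h2, ← mul_assoc, tsum_mul_right, tsum_toReal_poissonPMF_mul_pow]
  simp_rw [mul_assoc, mul_left_comm _ (Real.exp _), tsum_mul_left]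
  simp_rw [← mul_assoc, tsum_mul_right, tsum_toReal_poissonPMF_mul_pow, ← Real.exp_add]
  ring_nf

/-- A law satisfying both Stein identities satisfies the bivariate Poisson recursion. -/
theorem isRecursive_of_stein {l0 l1 l2 : ℝ} {p : PMF (ℕ × ℕ)}
    (hstein1 : ∀ f : ℕ × ℕ → ℝ, (∃ C : ℝ, ∀ q : ℕ × ℕ, |f q| ≤ C) →
      pExp p (fun q => (q.1 : ℝ) * f q)
        = l1 * pExp p (fun q => f (q.1 + 1, q.2))
          + l0 * pExp p (fun q => f (q.1 + 1, q.2 + 1)))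
    (hstein2 : ∀ f : ℕ × ℕ → ℝ, (∃ C : ℝ, ∀ q : ℕ × ℕ, |f q| ≤ C) →
      pExp p (fun q => (q.2 : ℝ) * f q)
        = l2 * pExp p (fun q => f (q.1, q.2 + 1))
          + l0 * pExp p (fun q => f (q.1 + 1, q.2 + 1))) :
    IsRecursive l0 l1 l2 fun q => (p q).toReal := by
  have key : ∀ (x : ℕ × ℕ) (f : ℕ × ℕ → ℝ), (∀ y, y ≠ x → f y = 0) →
      pExp p f = (p x).toReal * f x := fun x f hf =>
    tsum_eq_single x fun y hy => by rw [hf y hy, mul_zero]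
  have hbdd : ∀ x : ℕ × ℕ, ∃ C : ℝ, ∀ q, |(Pi.single x 1 : ℕ × ℕ → ℝ) q| ≤ C := fun x =>
    ⟨1, fun q => by by_cases h : q = x <;> simp [h]⟩
  constructor
  · intro a
    have h := hstein1 _ (hbdd (a + 1, 0))
    rw [key (a + 1, 0) _ (by intro y hy; simp [hy]),
      key (a, 0) _ (by rintro ⟨y, z⟩ hy; simpa [Pi.single_apply] using hy)] at h
    simp [pExp] at h
    linarith
  · intro a b
    have h := hstein1 _ (hbdd (a + 1, b + 1))
    rw [key (a + 1, b + 1) _ (by intro y hy; simp [hy]),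
      key (a, b + 1) _ (by rintro ⟨y, z⟩ hy; simpa [Pi.single_apply] using hy),
      key (a, b) _ (by rintro ⟨y, z⟩ hy; simpa [Pi.single_apply] using hy)] at h
    simp at h
    linarith
  · intro b
    have h := hstein2 _ (hbdd (0, b + 1))
    rw [key (0, b + 1) _ (by intro y hy; simp [hy]),
      key (0, b) _ (by rintro ⟨y, z⟩ hy; simpa [Pi.single_apply] using hy)] at h
    simp [pExp] at h
    linarith

end BivariatePoisson

theorem stein_bpoi_converse (l0 l1 l2 : ℝ≥0) (h0 : 0 < l0) (h1 : 0 < l1) (h2 : 0 < l2)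
    (p : PMF (ℕ × ℕ))
    (hstein1 : ∀ f : ℕ × ℕ → ℝ, (∃ C : ℝ, ∀ q : ℕ × ℕ, |f q| ≤ C) →
      pExp p (fun q => (q.1 : ℝ) * f q)
        = l1 * pExp p (fun q => f (q.1 + 1, q.2))
          + l0 * pExp p (fun q => f (q.1 + 1, q.2 + 1)))
    (hstein2 : ∀ f : ℕ × ℕ → ℝ, (∃ C : ℝ, ∀ q : ℕ × ℕ, |f q| ≤ C) →
      pExp p (fun q => (q.2 : ℝ) * f q)
        = l2 * pExp p (fun q => f (q.1, q.2 + 1))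
          + l0 * pExp p (fun q => f (q.1 + 1, q.2 + 1))) :
    p = bpoi l0 l1 l2 ∧
      ∀ s t : ℝ, |s| < 1 → |t| < 1 →
        (∑' q : ℕ × ℕ, (p q).toReal * s ^ q.1 * t ^ q.2)
          = Real.exp ((l1 : ℝ) * (s - 1) + (l2 : ℝ) * (t - 1) + (l0 : ℝ) * (s * t - 1)) := by
  obtain rfl : p = bpoi l0 l1 l2 :=
    BivariatePoisson.eq_of_isRecursive
      (BivariatePoisson.isRecursive_of_stein hstein1 hstein2)
      (BivariatePoisson.isRecursive_bpoi l0 l1 l2)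
  refine ⟨rfl, fun s t hs ht => ?_⟩
  simp_rw [mul_assoc (ENNReal.toReal _)]
  exact BivariatePoisson.tsum_toReal_bpoi_mul_pow_mul_pow l0 l1 l2 hs.le ht.le
end

section
/- Let ν > 0, π1, π2 ∈ (0, 1), π0 ∈ (−π1·π2, 1) with π• := π0 + π1 + π2 < 1, and let (X1, X2) follow the bivariate negative-binomial distribution BNB(ν; π1, π2, π0). Then for every bounded function f : ℕ × ℕ → ℝ, one has E[X1 · f(X1, X2)] − π2 · E[X1 · f(X1, X2 + 1)] = π1 · E[(ν + X1) · f(X1 + 1, X2)] + π0 · E[(ν + X1) · f(X1 + 1, X2 + 1)]. -/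
open scoped NNReal ENNReal

/-- `isBNB ν π1 π2 π0 p` says that `p` is the bivariate negative-binomial
distribution `BNB(ν; π1, π2, π0)`, i.e. its joint probability generating function
is `((1 - π•)/(1 - π1 s - π2 t - π0 s t))^ν` for all `|s|, |t| ≤ 1`,
where `π• = π0 + π1 + π2`. -/
def isBNB (ν π1 π2 π0 : ℝ) (p : PMF (ℕ × ℕ)) : Prop :=
  ∀ s t : ℝ, |s| ≤ 1 → |t| ≤ 1 →
    (∑' q : ℕ × ℕ, (p q).toReal * s ^ q.1 * t ^ q.2)
      = ((1 - (π0 + π1 + π2)) / (1 - π1 * s - π2 * t - π0 * s * t)) ^ ν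

open Filter Topology

lemma HasSum.of_eq {ι : Type*} {f g : ι → ℝ} {x y : ℝ} (h : HasSum f x)
    (hfg : ∀ i, g i = f i) (hxy : y = x) : HasSum g y := by
  rwa [hxy, funext hfg]

lemma eq_zero_of_eventually_hasSum_pow {d : ℕ → ℝ}
    (h : ∀ᶠ x : ℝ in 𝓝 0, HasSum (fun n => x ^ n * d n) 0) (n : ℕ) : d n = 0 := by
  have h1 : HasFPowerSeriesAt (0 : ℝ → ℝ) (FormalMultilinearSeries.ofScalars ℝ d) 0 := by
    rw [hasFPowerSeriesAt_iff]
    simpa [FormalMultilinearSeries.coeff_ofScalars] using h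
  rw [← FormalMultilinearSeries.coeff_ofScalars (p := d), h1.eq_zero]
  simp [FormalMultilinearSeries.coeff]

lemma succ_mul_ring_choose (r : ℝ) (k : ℕ) :
    ((k : ℝ) + 1) * Ring.choose r (k + 1) = (r - k) * Ring.choose r k := by
  have h := Ring.choose_smul_choose r (Nat.le_succ k)
  simp only [Nat.succ_eq_add_one, Nat.add_sub_cancel_left, Ring.choose_one_right,
    Nat.choose_succ_self_right, nsmul_eq_mul] at h
  push_cast at h
  linarith

lemma hasSum_choose_mul_pow (r : ℝ) {x : ℝ} (hx : |x| < 1) :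
    HasSum (fun n : ℕ => Ring.choose r n * x ^ n) ((1 + x) ^ r) := by
  have h := (Real.one_add_rpow_hasFPowerSeriesOnBall_zero (a := r)).hasSum (y := x) (by
    simpa [← ofReal_norm] using hx)
  simpa [binomialSeries, FormalMultilinearSeries.coeff_ofScalars, mul_comm] using h

/-- The power series coefficients of `s ↦ K (1 - u s) ^ (-ν)` satisfy a first order recurrence. -/
lemma coeff_recurrence_of_rpow {A : ℕ → ℝ} {K u ν : ℝ}
    (h : ∀ᶠ s : ℝ in 𝓝 0, HasSum (fun m => s ^ m * A m) (K * (1 + s * -u) ^ (-ν))) (m : ℕ) :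
    ((m : ℝ) + 1) * A (m + 1) = (ν + m) * u * A m := by
  have hA : ∀ m, A m = K * (Ring.choose (-ν) m * (-u) ^ m) := fun m => by
    refine sub_eq_zero.1 (eq_zero_of_eventually_hasSum_pow
      (d := fun m => A m - K * (Ring.choose (-ν) m * (-u) ^ m)) ?_ m)
    have hc : ∀ᶠ s : ℝ in 𝓝 0, |s * -u| < 1 := by
      have : Tendsto (fun s : ℝ => |s * -u|) (𝓝 0) (𝓝 |0 * -u|) := by
        apply Continuous.tendsto; fun_prop
      exact this.eventually_lt_const (by simp)
    filter_upwards [h, hc] with s hs hsu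
    have := hs.sub ((hasSum_choose_mul_pow (-ν) hsu).mul_left K)
    rw [sub_self] at this
    refine this.of_eq (fun m => ?_) rfl
    rw [mul_pow]
    ring
  rw [hA, hA, pow_succ]
  linear_combination (K * (-u) ^ m * (-u)) * succ_mul_ring_choose (-ν) m

/-- The coefficients of `x ∑ aₙ xⁿ`. -/
def shiftCoeff (a : ℕ → ℝ) : ℕ → ℝ
  | 0 => 0
  | n + 1 => a n

lemma HasSum.shiftCoeff {a : ℕ → ℝ} {x S : ℝ} (h : HasSum (fun n => x ^ n * a n) S) :
    HasSum (fun n => x ^ n * shiftCoeff a n) (x * S) := by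
  rw [← hasSum_nat_add_iff' 1]
  simpa [_root_.shiftCoeff, pow_succ', mul_assoc] using h.mul_left x

section
variable {a : ℕ × ℕ → ℝ} {ν π1 π2 π0 : ℝ}

lemma summable_pgf (ha : ∀ q, 0 ≤ a q) (hs : Summable a) {s t : ℝ} (h1 : |s| ≤ 1)
    (h2 : |t| ≤ 1) : Summable fun q : ℕ × ℕ => a q * s ^ q.1 * t ^ q.2 := by
  refine Summable.of_norm_bounded hs fun q => ?_
  rw [norm_mul, norm_mul, norm_pow, norm_pow, Real.norm_of_nonneg (ha q), mul_assoc]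
  refine mul_le_of_le_one_right (ha q) (mul_le_one₀ (pow_le_one₀ (norm_nonneg _) h1)
    (by positivity) (pow_le_one₀ (norm_nonneg _) h2))

lemma pgf_coeff_recurrence (hπ2 : π2 ∈ Set.Ioo (0 : ℝ) 1) (hb : π0 + π1 + π2 < 1)
    (ha : ∀ q, 0 ≤ a q) (hs : Summable a)
    (hG : ∀ s t : ℝ, |s| ≤ 1 → |t| ≤ 1 → (∑' q : ℕ × ℕ, a q * s ^ q.1 * t ^ q.2)
      = ((1 - (π0 + π1 + π2)) / (1 - π1 * s - π2 * t - π0 * s * t)) ^ ν) (m n : ℕ) :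
    ((m : ℝ) + 1) * (a (m + 1, n) - π2 * shiftCoeff (fun n => a (m + 1, n)) n)
      = (ν + m) * (π1 * a (m, n) + π0 * shiftCoeff (fun n => a (m, n)) n) := by
  have hA : ∀ (m : ℕ) (t : ℝ), |t| ≤ 1 →
      HasSum (fun n => t ^ n * a (m, n)) (∑' n, t ^ n * a (m, n)) := fun m t ht => by
    have h := (summable_pgf ha hs (s := 1) (by simp) ht).prod_factor m
    simp only [one_pow, mul_one] at h
    simpa [mul_comm] using h.hasSum
  refine sub_eq_zero.1 (eq_zero_of_eventually_hasSum_pow (d := fun n =>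
    ((m : ℝ) + 1) * (a (m + 1, n) - π2 * shiftCoeff (fun n => a (m + 1, n)) n)
      - (ν + m) * (π1 * a (m, n) + π0 * shiftCoeff (fun n => a (m, n)) n)) ?_ n)
  have hball : ∀ᶠ t : ℝ in 𝓝 0, |t| ≤ 1 :=
    (continuous_abs.tendsto (0 : ℝ)).eventually_le_const (by simp)
  filter_upwards [hball] with t ht
  have hD : 0 < 1 - π2 * t := by nlinarith [hπ2.1, hπ2.2, (abs_le.1 ht).2]
  have hrec := coeff_recurrence_of_rpow (A := fun m => ∑' n, t ^ n * a (m, n))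
    (K := ((1 - (π0 + π1 + π2)) / (1 - π2 * t)) ^ ν) (u := (π1 + π0 * t) / (1 - π2 * t))
    (ν := ν) (by
      have hc : ∀ᶠ s : ℝ in 𝓝 0, 0 < 1 + s * -((π1 + π0 * t) / (1 - π2 * t)) := by
        have : Tendsto (fun s : ℝ => 1 + s * -((π1 + π0 * t) / (1 - π2 * t))) (𝓝 0)
            (𝓝 (1 + 0 * -((π1 + π0 * t) / (1 - π2 * t)))) := by
          apply Continuous.tendsto; fun_prop
        exact this.eventually_const_lt (by simp)
      filter_upwards [hball, hc] with s hs1 hsu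
      have h1 := (summable_pgf ha hs hs1 ht).hasSum
      rw [hG s t hs1 ht] at h1
      have h2 := h1.prod_fiberwise (g := fun m => s ^ m * ∑' n, t ^ n * a (m, n)) (fun m => by
        exact ((hA m t ht).mul_left (s ^ m)).of_eq (fun n => by ring) rfl)
      have hden : 1 - π1 * s - π2 * t - π0 * s * t
          = (1 - π2 * t) * (1 + s * -((π1 + π0 * t) / (1 - π2 * t))) := by
        field_simp
        ring
      rw [hden, ← div_div, Real.div_rpow (div_pos (by linarith) hD).le hsu.le,
        div_eq_mul_inv, ← Real.rpow_neg hsu.le] at h2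
      exact h2) m
  have hS := (((hA (m + 1) t ht).sub ((hA (m + 1) t ht).shiftCoeff.mul_left π2)).mul_left
    ((m : ℝ) + 1)).sub ((((hA m t ht).mul_left π1).add
      ((hA m t ht).shiftCoeff.mul_left π0)).mul_left (ν + m))
  refine hS.of_eq (fun n => by ring) ?_
  field_simp at hrec
  rw [eq_div_iff (by linarith)] at hrec
  linear_combination -hrec

/-- The first marginal has a finite mean. -/
lemma summable_fst_mul_of_pgf (hb : π0 + π1 + π2 < 1)
    (ha : ∀ q, 0 ≤ a q) (hs : Summable a)
    (hG : ∀ s t : ℝ, |s| ≤ 1 → |t| ≤ 1 → (∑' q : ℕ × ℕ, a q * s ^ q.1 * t ^ q.2)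
      = ((1 - (π0 + π1 + π2)) / (1 - π1 * s - π2 * t - π0 * s * t)) ^ ν) :
    Summable fun q : ℕ × ℕ => (q.1 : ℝ) * a q := by
  set g : ℝ → ℝ := fun s =>
    ((1 - (π0 + π1 + π2)) / (1 - π1 * s - π2 * 1 - π0 * s * 1)) ^ ν with hg
  have hdiff : DifferentiableAt ℝ g 1 := by
    have hne : 1 - π1 * 1 - π2 * 1 - π0 * 1 * 1 ≠ 0 := by
      intro h; linarith
    refine DifferentiableAt.rpow_const ?_ (Or.inl (div_ne_zero (by linarith) hne))
    exact DifferentiableAt.div (by fun_prop) (by fun_prop) hne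
  have hlim : Tendsto (slope g 1) (𝓝[<] 1) (𝓝 (deriv g 1)) :=
    (hasDerivAt_iff_tendsto_slope.1 hdiff.hasDerivAt).mono_left
      (nhdsWithin_mono _ fun x hx => ne_of_lt hx)
  refine summable_of_sum_le (c := deriv g 1) (fun q => mul_nonneg (Nat.cast_nonneg _) (ha q))
    fun F => ?_
  have hFlim : Tendsto (fun s : ℝ => ∑ q ∈ F, a q * ∑ i ∈ Finset.range q.1, s ^ i)
      (𝓝[<] 1) (𝓝 (∑ q ∈ F, a q * ∑ i ∈ Finset.range q.1, (1 : ℝ) ^ i)) := by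
    refine (Continuous.tendsto ?_ 1).mono_left nhdsWithin_le_nhds
    fun_prop
  have key : ∑ q ∈ F, a q * ∑ i ∈ Finset.range q.1, (1 : ℝ) ^ i ≤ deriv g 1 := by
    refine le_of_tendsto_of_tendsto hFlim hlim ?_
    have hmem : Set.Ioo (0 : ℝ) 1 ∈ 𝓝[<] (1 : ℝ) := Ioo_mem_nhdsLT one_pos
    filter_upwards [hmem] with s hs01
    have hs1 : |s| ≤ 1 := abs_le.2 ⟨by linarith [hs01.1], hs01.2.le⟩
    have e1 := (summable_pgf ha hs (s := 1) (t := 1) (by simp) (by simp)).hasSum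
    have e2 := (summable_pgf ha hs (s := s) (t := 1) hs1 (by simp)).hasSum
    rw [hG _ _ (by simp) (by simp)] at e1
    rw [hG _ _ hs1 (by simp)] at e2
    have e3 := (e1.sub e2).div_const (1 - s)
    have h1s : 0 < 1 - s := by linarith [hs01.2]
    have e4 : HasSum (fun q : ℕ × ℕ => a q * ∑ i ∈ Finset.range q.1, s ^ i) (slope g 1 s) := by
      refine e3.of_eq (fun q => ?_) ?_
      · rw [eq_div_iff h1s.ne']
        have := geom_sum_mul s q.1
        simp only [one_pow, mul_one]
        linear_combination (-a q) * this
      · rw [slope_def_field, ← neg_sub 1 s, ← neg_sub (g 1), neg_div_neg_eq]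
    exact sum_le_hasSum F (fun q _ => mul_nonneg (ha q)
      (Finset.sum_nonneg fun i _ => pow_nonneg hs01.1.le i)) e4
  simpa [mul_comm] using key

end

lemma tsum_mul_comp_succ_snd (g h : ℕ × ℕ → ℝ) :
    ∑' q : ℕ × ℕ, g q * h (q.1, q.2 + 1)
      = ∑' q : ℕ × ℕ, shiftCoeff (fun n => g (q.1, n)) q.2 * h q := by
  have hinj : Function.Injective fun q : ℕ × ℕ => (q.1, q.2 + 1) := by
    rintro ⟨_, _⟩ ⟨_, _⟩ h; simpa using h
  refine hinj.tsum_eq (f := fun q : ℕ × ℕ => shiftCoeff (fun n => g (q.1, n)) q.2 * h q) ?_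
  rintro ⟨m, _ | n⟩ hq
  · simp [shiftCoeff] at hq
  · exact ⟨(m, n), rfl⟩

lemma summable_shiftCoeff_mul {g h : ℕ × ℕ → ℝ}
    (hgh : Summable fun q : ℕ × ℕ => g q * h (q.1, q.2 + 1)) :
    Summable fun q : ℕ × ℕ => shiftCoeff (fun n => g (q.1, n)) q.2 * h q := by
  have hinj : Function.Injective fun q : ℕ × ℕ => (q.1, q.2 + 1) := by
    rintro ⟨_, _⟩ ⟨_, _⟩ h; simpa using h
  refine (hinj.summable_iff ?_).1 hgh
  rintro ⟨m, _ | n⟩ hq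
  · simp [shiftCoeff]
  · exact absurd ⟨(m, n), rfl⟩ hq

lemma tsum_fst_mul_eq_tsum_succ (g : ℕ × ℕ → ℝ) :
    ∑' q : ℕ × ℕ, (q.1 : ℝ) * g q = ∑' q : ℕ × ℕ, ((q.1 : ℝ) + 1) * g (q.1 + 1, q.2) := by
  have hinj : Function.Injective fun q : ℕ × ℕ => (q.1 + 1, q.2) := by
    rintro ⟨_, _⟩ ⟨_, _⟩ h; simpa using h
  rw [← hinj.tsum_eq (f := fun q : ℕ × ℕ => (q.1 : ℝ) * g q)]
  · simp
  · rintro ⟨_ | m, n⟩ hq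
    · simp at hq
    · exact ⟨(m, n), rfl⟩

theorem stein_bnb_first (ν π1 π2 π0 : ℝ) (hν : 0 < ν)
    (hπ1 : π1 ∈ Set.Ioo (0 : ℝ) 1) (hπ2 : π2 ∈ Set.Ioo (0 : ℝ) 1)
    (hπ0 : π0 ∈ Set.Ioo (-(π1 * π2)) 1) (hb : π0 + π1 + π2 < 1)
    (p : PMF (ℕ × ℕ)) (hp : isBNB ν π1 π2 π0 p)
    (f : ℕ × ℕ → ℝ) (hf : ∃ C : ℝ, ∀ q : ℕ × ℕ, |f q| ≤ C) :
    pExp p (fun q => (q.1 : ℝ) * f q) - π2 * pExp p (fun q => (q.1 : ℝ) * f (q.1, q.2 + 1))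
      = π1 * pExp p (fun q => (ν + (q.1 : ℝ)) * f (q.1 + 1, q.2))
        + π0 * pExp p (fun q => (ν + (q.1 : ℝ)) * f (q.1 + 1, q.2 + 1)) := by
  obtain ⟨C, hC⟩ := hf
  set a : ℕ × ℕ → ℝ := fun q => (p q).toReal with ha_def
  have ha : ∀ q, 0 ≤ a q := fun q => ENNReal.toReal_nonneg
  have hs : Summable a := ENNReal.summable_toReal p.tsum_coe_ne_top
  have hmean : Summable fun q : ℕ × ℕ => (q.1 : ℝ) * a q := summable_fst_mul_of_pgf hb ha hs hp
  have hmean' : Summable fun q : ℕ × ℕ => (ν + (q.1 : ℝ)) * a q := by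
    simpa [add_mul] using (hs.mul_left ν).add hmean
  have hmean1 : Summable fun q : ℕ × ℕ => ((q.1 : ℝ) + 1) * a (q.1 + 1, q.2) := by
    have hinj : Function.Injective fun q : ℕ × ℕ => (q.1 + 1, q.2) := by
      rintro ⟨_, _⟩ ⟨_, _⟩ h; simpa using h
    simpa [Function.comp_def] using hmean.comp_injective hinj
  have hbdd : ∀ {g : ℕ × ℕ → ℝ}, Summable g → ∀ e : ℕ × ℕ → ℕ × ℕ,
      Summable fun q => g q * f (e q) := fun {g} hg e => by
    refine Summable.of_norm_bounded (hg.norm.mul_right C) fun q => ?_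
    rw [norm_mul]
    exact mul_le_mul_of_nonneg_left (hC _) (norm_nonneg _)
  have h1 : pExp p (fun q => (q.1 : ℝ) * f q)
      = ∑' q : ℕ × ℕ, ((q.1 : ℝ) + 1) * a (q.1 + 1, q.2) * f (q.1 + 1, q.2) := by
    simp only [mul_assoc]
    rw [← tsum_fst_mul_eq_tsum_succ (fun q => a q * f q)]
    exact tsum_congr fun q => by simp only [ha_def]; ring
  have h2 : pExp p (fun q => (q.1 : ℝ) * f (q.1, q.2 + 1))
      = ∑' q : ℕ × ℕ, shiftCoeff (fun n => ((q.1 : ℝ) + 1) * a (q.1 + 1, n)) q.2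
          * f (q.1 + 1, q.2) := by
    rw [← tsum_mul_comp_succ_snd (fun q => ((q.1 : ℝ) + 1) * a (q.1 + 1, q.2))
      (fun q => f (q.1 + 1, q.2))]
    simp only [mul_assoc]
    rw [← tsum_fst_mul_eq_tsum_succ (fun q => a q * f (q.1, q.2 + 1))]
    exact tsum_congr fun q => by simp only [ha_def]; ring
  have h3 : pExp p (fun q => (ν + (q.1 : ℝ)) * f (q.1 + 1, q.2))
      = ∑' q : ℕ × ℕ, (ν + (q.1 : ℝ)) * a q * f (q.1 + 1, q.2) :=
    tsum_congr fun q => by simp only [ha_def]; ring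
  have h4 : pExp p (fun q => (ν + (q.1 : ℝ)) * f (q.1 + 1, q.2 + 1))
      = ∑' q : ℕ × ℕ, shiftCoeff (fun n => (ν + (q.1 : ℝ)) * a (q.1, n)) q.2
          * f (q.1 + 1, q.2) := by
    rw [← tsum_mul_comp_succ_snd (fun q => (ν + (q.1 : ℝ)) * a q) (fun q => f (q.1 + 1, q.2))]
    exact tsum_congr fun q => by simp only [ha_def]; ring
  have s1 := hbdd hmean1 fun q => (q.1 + 1, q.2)
  have s2 := summable_shiftCoeff_mul (h := fun q => f (q.1 + 1, q.2))
    (hbdd hmean1 fun q => (q.1 + 1, q.2 + 1))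
  have s3 := hbdd hmean' fun q => (q.1 + 1, q.2)
  have s4 := summable_shiftCoeff_mul (h := fun q => f (q.1 + 1, q.2))
    (hbdd hmean' fun q => (q.1 + 1, q.2 + 1))
  rw [h1, h2, h3, h4, ← tsum_mul_left, ← tsum_mul_left, ← tsum_mul_left,
    ← s1.tsum_sub (s2.mul_left π2), ← (s3.mul_left π1).tsum_add (s4.mul_left π0)]
  refine tsum_congr ?_
  rintro ⟨m, n⟩
  have hrec := pgf_coeff_recurrence hπ2 hb ha hs hp m n
  cases n with
  | zero =>
    simp only [shiftCoeff] at hrec ⊢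
    linear_combination f (m + 1, 0) * hrec
  | succ n =>
    simp only [shiftCoeff] at hrec ⊢
    linear_combination f (m + 1, n + 1) * hrec
end

section
/- Let ν > 0, π1, π2 ∈ (0, 1), π0 ∈ (−π1·π2, 1) with π• := π0 + π1 + π2 < 1, and let (X1, X2) follow the bivariate negative-binomial distribution BNB(ν; π1, π2, π0). For integers r, s ≥ 0, let μ_(r,s) = E[(X1)_(r) · (X2)_(s)] denote the joint factorial moments, where x_(k) = x(x−1)⋯(x−k+1) is the falling factorial with x_(0) = 1. Then for all integers r ≥ 1 and s ≥ 1: (1 − π•)·μ_(r,s) = (ν + r − 1)·(π1 + π0)·μ_(r−1,s) + s·(π2 + π0)·μ_(r,s−1) + (ν + r − 1)·s·π0·μ_(r−1,s−1). -/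
open scoped NNReal ENNReal

/-- The joint factorial moment `μ_(r,s) = E[(X1)_(r) (X2)_(s)]` of a distribution
on `ℕ × ℕ`, where `x_(k) = x (x-1) ⋯ (x-k+1)` is the falling factorial. -/
noncomputable def factMoment (p : PMF (ℕ × ℕ)) (r s : ℕ) : ℝ :=
  ∑' q : ℕ × ℕ, (p q).toReal * (q.1.descFactorial r : ℝ) * (q.2.descFactorial s : ℝ)

open Filter Topology

theorem hasSum_of_eq {ι : Type*} {f g : ι → ℝ} {a b : ℝ} (h : HasSum f a)
    (hfg : ∀ i, g i = f i) (hab : b = a) : HasSum g b := by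
  rwa [hab, funext hfg]

theorem eq_of_eventually_hasSum_mul_pow {a b : ℕ → ℝ} {f : ℝ → ℝ}
    (ha : ∀ᶠ x in 𝓝 (0 : ℝ), HasSum (fun n => a n * x ^ n) (f x))
    (hb : ∀ᶠ x in 𝓝 (0 : ℝ), HasSum (fun n => b n * x ^ n) (f x)) : a = b := by
  have key : ∀ c : ℕ → ℝ, (∀ᶠ x in 𝓝 (0 : ℝ), HasSum (fun n => c n * x ^ n) (f x)) →
      HasFPowerSeriesAt f (FormalMultilinearSeries.ofScalars ℝ c) 0 := by
    intro c hc
    rw [hasFPowerSeriesAt_iff]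
    filter_upwards [hc] with x hx
    simpa [FormalMultilinearSeries.coeff_ofScalars, mul_comm] using hx
  have h := (key a ha).eq_formalMultilinearSeries (key b hb)
  exact FormalMultilinearSeries.ofScalars_series_injective ℝ ℝ h

theorem succ_mul_ringChoose_succ (r : ℝ) (n : ℕ) :
    ((n : ℝ) + 1) * Ring.choose r (n + 1) = (r - n) * Ring.choose r n := by
  rw [Ring.choose_eq_smul, Ring.choose_eq_smul, descPochhammer_succ_right, Polynomial.smeval_mul,
    Nat.factorial_succ]
  have h : (n.factorial : ℝ) ≠ 0 := by positivity
  simp [Polynomial.smeval_natCast]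
  field_simp

theorem eventually_hasSum_binomial (a γ : ℝ) :
    ∀ᶠ x in 𝓝 (0 : ℝ),
      HasSum (fun n => Ring.choose a n * γ ^ n * x ^ n) ((1 + γ * x) ^ a) := by
  have h := hasFPowerSeriesAt_iff.1 (Real.one_add_rpow_hasFPowerSeriesAt_zero (a := a))
  have ht : Tendsto (fun x : ℝ => γ * x) (𝓝 0) (𝓝 0) := by
    simpa using (continuous_const_mul γ).tendsto 0
  filter_upwards [ht.eventually h] with x hx
  simpa [binomialSeries, FormalMultilinearSeries.coeff_ofScalars, mul_pow, mul_comm,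
    mul_left_comm, mul_assoc] using hx

/-- Coefficients of a power series representing `K * (1 + γ x) ^ (-ν)` near zero satisfy a
first-order recursion. -/
theorem coeff_recursion_of_hasSum {a : ℕ → ℝ} {K γ ν : ℝ}
    (h : ∀ᶠ x in 𝓝 (0 : ℝ), HasSum (fun n => a n * x ^ n) (K * (1 + γ * x) ^ (-ν))) (n : ℕ) :
    ((n : ℝ) + 1) * a (n + 1) = (ν + n) * (-γ) * a n := by
  have hb : ∀ᶠ x in 𝓝 (0 : ℝ), HasSum (fun n => K * (Ring.choose (-ν) n * γ ^ n) * x ^ n)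
      (K * (1 + γ * x) ^ (-ν)) := by
    filter_upwards [eventually_hasSum_binomial (-ν) γ] with x hx
    simpa [mul_assoc] using hx.mul_left K
  rw [eq_of_eventually_hasSum_mul_pow h hb]
  have := succ_mul_ringChoose_succ (-ν) n
  simp only [pow_succ]
  linear_combination K * γ ^ n * γ * this

/-- Delay a sequence by one index, starting with zero. -/
def delay (a : ℕ → ℝ) : ℕ → ℝ
  | 0 => 0
  | n + 1 => a n

theorem hasSum_delay_mul {a w : ℕ → ℝ} {S : ℝ} (h : HasSum (fun n => a n * w (n + 1)) S) :
    HasSum (fun n => delay a n * w n) S := by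
  rw [← hasSum_nat_add_iff' 1]
  simpa [delay] using h

theorem mul_descFactorial (n s : ℕ) :
    (n : ℝ) * n.descFactorial s = n.descFactorial (s + 1) + s * n.descFactorial s := by
  rcases le_or_gt s n with h | h
  · rw [Nat.descFactorial_succ]
    push_cast [h]
    ring
  · simp [Nat.descFactorial_of_lt h]

theorem descFactorial_succ_left (n s : ℕ) :
    ((n + 1).descFactorial s : ℝ)
      = n.descFactorial s + s * n.descFactorial (s - 1) := by
  cases s with
  | zero => simp
  | succ s =>
    rw [Nat.succ_descFactorial_succ]
    have h := mul_descFactorial n s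
    push_cast [Nat.add_sub_cancel]
    linear_combination h

section

variable {P : ℕ × ℕ → ℝ} {ν π1 π2 π0 : ℝ}

theorem row_gf_recursion (hP : ∀ q, 0 ≤ P q) (hs : Summable P)
    (hG : ∀ s t : ℝ, |s| ≤ 1 → |t| ≤ 1 → (∑' q : ℕ × ℕ, P q * s ^ q.1 * t ^ q.2)
      = ((1 - (π0 + π1 + π2)) / (1 - π1 * s - π2 * t - π0 * s * t)) ^ ν)
    (hπ2 : π2 ∈ Set.Ioo (0 : ℝ) 1) (hb : π0 + π1 + π2 < 1) {t : ℝ} (ht : |t| ≤ 1) (m : ℕ) :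
    (1 - π2 * t) * (((m : ℝ) + 1) * ∑' n, P (m + 1, n) * t ^ n)
      = (ν + m) * (π1 + π0 * t) * ∑' n, P (m, n) * t ^ n := by
  have hα : 0 < 1 - π2 * t := by
    have := (abs_le.1 ht).2
    nlinarith [hπ2.1, hπ2.2]
  set α := 1 - π2 * t with hαdef
  have hsum : ∀ s : ℝ, |s| ≤ 1 → Summable fun q : ℕ × ℕ => P q * s ^ q.1 * t ^ q.2 := by
    intro s hs1
    refine Summable.of_norm_bounded hs fun q => ?_
    rw [norm_mul, norm_mul, norm_pow, norm_pow, Real.norm_of_nonneg (hP q), mul_assoc]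
    refine mul_le_of_le_one_right (hP q) ?_
    exact mul_le_one₀ (pow_le_one₀ (norm_nonneg _) hs1) (by positivity)
      (pow_le_one₀ (norm_nonneg _) ht)
  have hgf : ∀ᶠ s in 𝓝 (0 : ℝ), HasSum (fun m => (∑' n, P (m, n) * t ^ n) * s ^ m)
      (((1 - (π0 + π1 + π2)) / α) ^ ν * (1 + -(π1 + π0 * t) / α * s) ^ (-ν)) := by
    have h1 : ∀ᶠ s in 𝓝 (0 : ℝ), |s| < 1 :=
      (continuous_abs.tendsto (0 : ℝ)).eventually (gt_mem_nhds (by simp))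
    have h2 : ∀ᶠ s in 𝓝 (0 : ℝ), 0 < 1 + -(π1 + π0 * t) / α * s := by
      have : Continuous fun s : ℝ => 1 + -(π1 + π0 * t) / α * s := by fun_prop
      exact (this.tendsto 0).eventually (lt_mem_nhds (by simp))
    filter_upwards [h1, h2] with s hs1 hs2
    have hh := (hsum s hs1.le).hasSum.prod_fiberwise
      fun m => ((hsum s hs1.le).prod_factor m).hasSum
    rw [hG s t hs1.le ht] at hh
    convert hh using 1
    · funext m
      rw [← tsum_mul_right]
      exact tsum_congr fun n => by ring
    · rw [Real.rpow_neg hs2.le, ← Real.inv_rpow hs2.le, ← Real.mul_rpow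
        (div_nonneg (by linarith) hα.le) (by positivity)]
      congr 1
      have h3 : 1 - π1 * s - π2 * t - π0 * s * t
          = α * (1 + -(π1 + π0 * t) / α * s) := by
        field_simp
        rw [hαdef]
        ring
      rw [h3, div_mul_eq_div_div]
      rfl
  have h := coeff_recursion_of_hasSum hgf m
  field_simp at h
  linear_combination h

theorem mass_recursion (hP : ∀ q, 0 ≤ P q) (hs : Summable P)
    (hG : ∀ s t : ℝ, |s| ≤ 1 → |t| ≤ 1 → (∑' q : ℕ × ℕ, P q * s ^ q.1 * t ^ q.2)
      = ((1 - (π0 + π1 + π2)) / (1 - π1 * s - π2 * t - π0 * s * t)) ^ ν)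
    (hπ2 : π2 ∈ Set.Ioo (0 : ℝ) 1) (hb : π0 + π1 + π2 < 1) (m n : ℕ) :
    ((m : ℝ) + 1) * (P (m + 1, n) - π2 * delay (fun k => P (m + 1, k)) n)
      = (ν + m) * (π1 * P (m, n) + π0 * delay (fun k => P (m, k)) n) := by
  have h1 : ∀ᶠ t in 𝓝 (0 : ℝ), |t| < 1 :=
    (continuous_abs.tendsto (0 : ℝ)).eventually (gt_mem_nhds (by simp))
  have hrow : ∀ t : ℝ, |t| < 1 → ∀ i, HasSum (fun k => P (i, k) * t ^ k)
      (∑' k, P (i, k) * t ^ k) := by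
    intro t ht i
    refine (Summable.of_norm_bounded (hs.prod_factor i) fun k => ?_).hasSum
    rw [norm_mul, norm_pow, Real.norm_of_nonneg (hP _)]
    exact mul_le_of_le_one_right (hP _) (pow_le_one₀ (norm_nonneg _) ht.le)
  have hdel : ∀ t : ℝ, |t| < 1 → ∀ i, HasSum (fun k => delay (fun l => P (i, l)) k * t ^ k)
      (t * ∑' k, P (i, k) * t ^ k) := by
    intro t ht i
    refine hasSum_delay_mul (w := fun k => t ^ k) ?_
    exact hasSum_of_eq ((hrow t ht i).mul_left t) (fun k => by ring) rfl
  refine congrFun (eq_of_eventually_hasSum_mul_pow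
    (a := fun n => ((m : ℝ) + 1) * (P (m + 1, n) - π2 * delay (fun k => P (m + 1, k)) n))
    (b := fun n => (ν + m) * (π1 * P (m, n) + π0 * delay (fun k => P (m, k)) n))
    (f := fun t => (1 - π2 * t) * (((m : ℝ) + 1) * ∑' n, P (m + 1, n) * t ^ n)) ?_ ?_) n
  · filter_upwards [h1] with t ht
    exact hasSum_of_eq
      (((hrow t ht (m + 1)).sub ((hdel t ht (m + 1)).mul_left π2)).mul_left ((m : ℝ) + 1))
      (fun k => by ring) (by ring)
  · filter_upwards [h1] with t ht
    rw [row_gf_recursion hP hs hG hπ2 hb ht.le]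
    exact hasSum_of_eq
      ((((hrow t ht m).mul_left π1).add ((hdel t ht m).mul_left π0)).mul_left (ν + m))
      (fun k => by ring) (by ring)

theorem summable_pow_mul_of_recursion {q : ℕ → ℝ} {a : ℝ} (hq : ∀ n, 0 ≤ q n) (ha : a < 1)
    (h : ∀ n : ℕ, ((n : ℝ) + 1) * q (n + 1) = a * (ν + n) * q n) (k : ℕ) :
    Summable fun n => q n * (n : ℝ) ^ k := by
  obtain ⟨r, har, hr⟩ := exists_between ha
  have hinv : Tendsto (fun n : ℕ => ((n : ℝ))⁻¹) atTop (𝓝 0) := tendsto_inv_atTop_nhds_zero_nat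
  have hlim : Tendsto (fun n : ℕ => a * ((ν * (n : ℝ)⁻¹ + 1) / (1 + (n : ℝ)⁻¹))
      * (1 + (n : ℝ)⁻¹) ^ k) atTop (𝓝 (a * ((ν * 0 + 1) / (1 + 0)) * (1 + 0) ^ k)) := by
    have h1 := (hinv.const_mul ν).add_const 1
    have h2 := hinv.const_add 1
    exact ((h1.div h2 (by norm_num)).const_mul a).mul (h2.pow k)
  have har' : a * ((ν * 0 + 1) / (1 + 0)) * (1 + 0) ^ k < r := by simpa using har
  refine summable_of_ratio_norm_eventually_le hr ?_
  filter_upwards [hlim.eventually (gt_mem_nhds har'), eventually_gt_atTop 0] with n hn hn0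
  have hn1 : (0 : ℝ) < n := by exact_mod_cast hn0
  rw [Real.norm_of_nonneg (mul_nonneg (hq _) (by positivity)),
    Real.norm_of_nonneg (mul_nonneg (hq _) (by positivity))]
  have h1 : q (n + 1) = a * ((ν * (n : ℝ)⁻¹ + 1) / (1 + (n : ℝ)⁻¹)) * q n := by
    have := h n
    field_simp
    linear_combination this
  have h2 : ((n + 1 : ℕ) : ℝ) ^ k = (1 + (n : ℝ)⁻¹) ^ k * (n : ℝ) ^ k := by
    rw [← mul_pow]
    congr 1
    push_cast
    field_simp
  rw [h1, h2]
  have := mul_le_mul_of_nonneg_right hn.le (mul_nonneg (hq n) (pow_nonneg hn1.le k))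
  linarith

theorem summable_fst_pow (hP : ∀ q, 0 ≤ P q) (hs : Summable P)
    (hG : ∀ s t : ℝ, |s| ≤ 1 → |t| ≤ 1 → (∑' q : ℕ × ℕ, P q * s ^ q.1 * t ^ q.2)
      = ((1 - (π0 + π1 + π2)) / (1 - π1 * s - π2 * t - π0 * s * t)) ^ ν)
    (hπ2 : π2 ∈ Set.Ioo (0 : ℝ) 1) (hb : π0 + π1 + π2 < 1) (k : ℕ) :
    Summable fun q : ℕ × ℕ => P q * (q.1 : ℝ) ^ k := by
  rw [summable_prod_of_nonneg fun q => mul_nonneg (hP q) (by positivity)]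
  refine ⟨fun m => ?_, ?_⟩
  · have h := (hs.prod_factor m).mul_right ((m : ℝ) ^ k)
    exact h
  have h2 : 0 < 1 - π2 := by linarith [hπ2.2]
  have := summable_pow_mul_of_recursion (ν := ν) (q := fun m => ∑' n, P (m, n))
    (a := (π1 + π0) / (1 - π2)) (fun m => tsum_nonneg fun n => hP _)
    ((div_lt_one h2).2 (by linarith)) (fun m => by
      have := row_gf_recursion hP hs hG hπ2 hb (t := 1) (by simp) m
      simp only [one_pow, mul_one] at this
      field_simp
      linear_combination this) k
  simpa only [tsum_mul_right] using this

theorem summable_descFactorial_mul (hP : ∀ q, 0 ≤ P q) (hs : Summable P)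
    (hG : ∀ s t : ℝ, |s| ≤ 1 → |t| ≤ 1 → (∑' q : ℕ × ℕ, P q * s ^ q.1 * t ^ q.2)
      = ((1 - (π0 + π1 + π2)) / (1 - π1 * s - π2 * t - π0 * s * t)) ^ ν)
    (hπ1 : π1 ∈ Set.Ioo (0 : ℝ) 1) (hπ2 : π2 ∈ Set.Ioo (0 : ℝ) 1) (hb : π0 + π1 + π2 < 1)
    (i j : ℕ) :
    Summable fun q : ℕ × ℕ => P q * (q.1.descFactorial i : ℝ) * (q.2.descFactorial j : ℝ) := by
  have hfst := summable_fst_pow hP hs hG hπ2 hb (2 * i)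
  have hsnd : Summable fun q : ℕ × ℕ => P q * (q.2 : ℝ) ^ (2 * j) := by
    have := summable_fst_pow (P := fun q => P q.swap) (ν := ν) (π1 := π2) (π2 := π1) (π0 := π0)
      (fun q => hP _) ((Equiv.prodComm ℕ ℕ).summable_iff.2 hs) (fun s t hs1 ht1 => by
        rw [show 1 - (π0 + π2 + π1) = 1 - (π0 + π1 + π2) by ring,
          show 1 - π2 * s - π1 * t - π0 * s * t = 1 - π1 * t - π2 * s - π0 * t * s by ring,
          ← hG t s ht1 hs1, ← (Equiv.prodComm ℕ ℕ).tsum_eq]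
        refine tsum_congr fun q => ?_
        simp only [Equiv.prodComm_apply, Prod.swap_swap, Prod.fst_swap, Prod.snd_swap]
        ring) hπ1 (by linarith) (2 * j)
    exact (Equiv.prodComm ℕ ℕ).summable_iff.1 (by simpa [Function.comp_def] using this)
  refine Summable.of_nonneg_of_le (fun q => by have := hP q; positivity) (fun q => ?_)
    (hfst.add hsnd)
  have h1 : (q.1.descFactorial i : ℝ) ≤ (q.1 : ℝ) ^ i := by
    exact_mod_cast Nat.descFactorial_le_pow _ _
  have h2 : (q.2.descFactorial j : ℝ) ≤ (q.2 : ℝ) ^ j := by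
    exact_mod_cast Nat.descFactorial_le_pow _ _
  have h3 : (q.1.descFactorial i : ℝ) * (q.2.descFactorial j : ℝ)
      ≤ (q.1 : ℝ) ^ (2 * i) + (q.2 : ℝ) ^ (2 * j) := by
    refine (mul_le_mul h1 h2 (by positivity) (by positivity)).trans ?_
    rw [pow_mul', pow_mul']
    nlinarith [sq_nonneg ((q.1 : ℝ) ^ i - (q.2 : ℝ) ^ j), sq_nonneg ((q.1 : ℝ) ^ i),
      sq_nonneg ((q.2 : ℝ) ^ j)]
  rw [mul_assoc, ← mul_add]
  exact mul_le_mul_of_nonneg_left h3 (hP q)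

end

theorem bnb_factorial_moment_recursion (ν π1 π2 π0 : ℝ) (hν : 0 < ν)
    (hπ1 : π1 ∈ Set.Ioo (0 : ℝ) 1) (hπ2 : π2 ∈ Set.Ioo (0 : ℝ) 1)
    (hπ0 : π0 ∈ Set.Ioo (-(π1 * π2)) 1) (hb : π0 + π1 + π2 < 1)
    (p : PMF (ℕ × ℕ)) (hp : isBNB ν π1 π2 π0 p) :
    ∀ r s : ℕ, 1 ≤ r → 1 ≤ s →
      (1 - (π0 + π1 + π2)) * factMoment p r s
        = (ν + (r : ℝ) - 1) * (π1 + π0) * factMoment p (r - 1) s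
          + (s : ℝ) * (π2 + π0) * factMoment p r (s - 1)
          + (ν + (r : ℝ) - 1) * (s : ℝ) * π0 * factMoment p (r - 1) (s - 1) := by
  intro r s hr _
  obtain ⟨r, rfl⟩ := Nat.exists_eq_add_of_le' hr
  set P : ℕ × ℕ → ℝ := fun q => (p q).toReal with hPdef
  have hP : ∀ q, 0 ≤ P q := fun q => ENNReal.toReal_nonneg
  have hs : Summable P := ENNReal.summable_toReal (by simp [p.tsum_coe])
  have hmom := summable_descFactorial_mul hP hs hp hπ1 hπ2 hb
  have hrow : ∀ i j : ℕ, Summable fun n => P (i, n) * (n.descFactorial j : ℝ) := by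
    intro i j
    have h := (hmom 0 j).prod_factor i
    simpa using h
  set S : ℕ → ℕ → ℝ := fun i j => ∑' n, P (i, n) * (n.descFactorial j : ℝ) with hS
  have hM : ∀ i j : ℕ,
      HasSum (fun m => S m j * (m.descFactorial i : ℝ)) (factMoment p i j) := by
    intro i j
    have h := (hmom i j).hasSum.prod_fiberwise fun m => ((hmom i j).prod_factor m).hasSum
    refine hasSum_of_eq h (fun m => ?_) rfl
    rw [hS, ← tsum_mul_right]
    exact tsum_congr fun n => by ring
  have hrec : ∀ m : ℕ, ((m : ℝ) + 1) * (S (m + 1) s - π2 * (S (m + 1) s + s * S (m + 1) (s - 1)))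
      = (ν + m) * (π1 * S m s + π0 * (S m s + s * S m (s - 1))) := by
    intro m
    have h1 : ∀ i, HasSum (fun n => P (i, n) * (n.descFactorial s : ℝ)) (S i s) :=
      fun i => (hrow i s).hasSum
    have h2 : ∀ i, HasSum (fun n => delay (fun k => P (i, k)) n * (n.descFactorial s : ℝ))
        (S i s + s * S i (s - 1)) := by
      intro i
      refine hasSum_delay_mul (w := fun n => (n.descFactorial s : ℝ)) ?_
      refine hasSum_of_eq ((h1 i).add ((hrow i (s - 1)).hasSum.mul_left (s : ℝ)))
        (fun n => ?_) rfl
      rw [descFactorial_succ_left]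
      ring
    refine HasSum.unique (((h1 (m + 1)).sub ((h2 (m + 1)).mul_left π2)).mul_left ((m : ℝ) + 1)) ?_
    refine hasSum_of_eq ((((h1 m).mul_left π1).add ((h2 m).mul_left π0)).mul_left (ν + m))
      (fun n => ?_) rfl
    have h := mass_recursion hP hs hp hπ2 hb m n
    linear_combination (n.descFactorial s : ℝ) * h
  have hshift : ∀ j, HasSum (fun m : ℕ => ((m : ℝ) + 1) * S (m + 1) j * (m.descFactorial r : ℝ))
      (factMoment p (r + 1) j) := by
    intro j
    have h := (hasSum_nat_add_iff' 1).2 (hM (r + 1) j)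
    simp only [Finset.sum_range_one, Nat.zero_descFactorial_succ, Nat.cast_zero, mul_zero,
      sub_zero, Nat.succ_descFactorial_succ] at h
    exact hasSum_of_eq h (fun m => by push_cast; ring) rfl
  have hmul : ∀ j, HasSum (fun m : ℕ => (ν + m) * S m j * (m.descFactorial r : ℝ))
      ((ν + r) * factMoment p r j + factMoment p (r + 1) j) := by
    intro j
    refine hasSum_of_eq (((hM r j).mul_left (ν + r)).add (hM (r + 1) j)) (fun m => ?_) rfl
    linear_combination S m j * mul_descFactorial m r
  have hfin := HasSum.unique
    ((hshift s).sub (((hshift s).add ((hshift (s - 1)).mul_left (s : ℝ))).mul_left π2))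
    (a₂ := π1 * ((ν + r) * factMoment p r s + factMoment p (r + 1) s)
      + π0 * (((ν + r) * factMoment p r s + factMoment p (r + 1) s)
        + s * ((ν + r) * factMoment p r (s - 1) + factMoment p (r + 1) (s - 1)))) (by
      refine hasSum_of_eq (((hmul s).mul_left π1).add
        (((hmul s).add ((hmul (s - 1)).mul_left (s : ℝ))).mul_left π0)) (fun m => ?_) rfl
      linear_combination (m.descFactorial r : ℝ) * hrec m)
  simp only [Nat.add_sub_cancel]
  push_cast
  linear_combination hfin
end
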